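/- arXiv:math/0409383 — 2 statements merged into one kernel-verified Lean document; each statement's English description precedes it below -/
import Mathlib

section
/- The only integral points (x,y) with y > 0 on the elliptic curve y² = x³ - 12x + 4 are (x,y) = (0,2) and (x,y) = (9,25). -/
/-! Two-descent: the point `(x, y)` gives the binary quartic form
`X⁴ - 6x X²Z² + 8y XZ³ + (48 - 3x²) Z⁴`, with invariants `48`, `-16`.  For `x ≥ 4` we reduce it with
`SL₂(ℤ)`, find that it has an integral root, and conclude that `(x, y)` is the double of an integral
point. -/

/-- Coprime short vector of a positive definite binary quadratic form. -/
theorem exists_short_vector (A B C : ℝ) (hA : 0 < A) (hD : 0 < A * C - B ^ 2) :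
    ∃ m n k l : ℤ, m * l - k * n = 1 ∧
      0 < A * m ^ 2 + 2 * B * m * n + C * n ^ 2 ∧
      3 * (A * m ^ 2 + 2 * B * m * n + C * n ^ 2) ^ 2 ≤ 4 * (A * C - B ^ 2) := by
  have hs : 0 < Real.sqrt (A * C - B ^ 2) := Real.sqrt_pos.mpr hD
  have hs2 : Real.sqrt (A * C - B ^ 2) ^ 2 = A * C - B ^ 2 := Real.sq_sqrt hD.le
  set s := Real.sqrt (A * C - B ^ 2) with hsdef
  let z : UpperHalfPlane := ⟨⟨B / A, s / A⟩, div_pos hs hA⟩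
  have hzre : z.re = B / A := rfl
  have hzim : z.im = s / A := rfl
  obtain ⟨g, hg⟩ := ModularGroup.exists_smul_mem_fd z
  have h3 := ModularGroup.three_le_four_mul_im_sq_of_mem_fd hg
  have hpos := UpperHalfPlane.normSq_denom_pos (g : GL (Fin 2) ℝ) z.im_ne_zero
  rw [ModularGroup.im_smul_eq_div_normSq] at h3
  have hdet := g.det_coe
  rw [Matrix.det_fin_two] at hdet
  have hn : Complex.normSq (UpperHalfPlane.denom (g : GL (Fin 2) ℝ) z)
      = (g 1 0 * (B / A) + g 1 1) ^ 2 + (g 1 0 * (s / A)) ^ 2 := by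
    rw [ModularGroup.denom_apply, Complex.normSq_apply]
    simp
    rw [hzre, hzim]
    ring
  have hq : A * Complex.normSq (UpperHalfPlane.denom (g : GL (Fin 2) ℝ) z)
      = A * ((g 1 1 : ℤ) : ℝ) ^ 2 + 2 * B * ((g 1 1 : ℤ) : ℝ) * ((g 1 0 : ℤ) : ℝ)
        + C * ((g 1 0 : ℤ) : ℝ) ^ 2 := by
    rw [hn]
    field_simp
    rw [hs2]
    ring
  refine ⟨g 1 1, g 1 0, g 0 1, g 0 0, by linarith, ?_, ?_⟩
  · rw [← hq]; positivity
  · rw [← hq, ← hs2]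
    rw [hzim, div_div, div_pow] at h3
    have : 0 < (A * Complex.normSq (UpperHalfPlane.denom (g : GL (Fin 2) ℝ) z)) ^ 2 := by
      positivity
    rw [← mul_div_assoc, le_div_iff₀ this] at h3
    linarith

theorem exists_theta : ∃ θ : ℝ, 0.33 < θ ∧ θ < 0.34 ∧ θ ^ 3 - 12 * θ + 4 = 0 := by
  have hc : ContinuousOn (fun θ : ℝ => θ ^ 3 - 12 * θ + 4) (Set.Icc 0.33 0.34) := by fun_prop
  have := intermediate_value_Ioo' (by norm_num : (0.33 : ℝ) ≤ 0.34) hc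
  obtain ⟨θ, hθ, h0⟩ := this (show (0 : ℝ) ∈ _ by constructor <;> norm_num)
  exact ⟨θ, hθ.1, hθ.2, h0⟩

set_option synthInstance.maxSize 2000 in
set_option synthInstance.maxHeartbeats 200000 in
/-- The finite search. -/
theorem finite_search : ∀ a ∈ Finset.Icc (-4 : ℤ) 5, ∀ H ∈ Finset.Icc (0 : ℤ) 17,
    ∀ j ∈ Finset.range 150, ((j : ℤ) ^ 2 = 4 * H ^ 3 - 48 * a ^ 2 * H + 16 * a ^ 3) →
    3 * a ≤ H → -7 * a ≤ 2 * H →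
    a = 0 ∨ (a = 1 ∧ H = 9) ∨ (a = -3 ∧ H = 12) := by
  decide +kernel

theorem pair_cases (a H k : ℤ) (θ : ℝ) (h1 : 0.33 < θ) (h2 : θ < 0.34)
    (h0 : θ ^ 3 - 12 * θ + 4 = 0) (hp : 0 < H - θ * a) (hp_1 : (H - θ * a : ℝ) ≤ 16 - 4 * θ ^ 2)
    (hk : k ^ 2 = 4 * H ^ 3 - 48 * a ^ 2 * H + 16 * a ^ 3) :
    a = 0 ∨ (a = 1 ∧ H = 9) ∨ (a = -3 ∧ H = 12) := by
  have hkR : (k : ℝ) ^ 2 = 4 * H ^ 3 - 48 * a ^ 2 * H + 16 * a ^ 3 := by exact_mod_cast hk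
  have hp_2 : (H - θ * a : ℝ) ≤ 15.6 := by nlinarith
  have hfac : 0 ≤ (H : ℝ) ^ 2 + a * θ * H + a ^ 2 * (θ ^ 2 - 12) := by
    have : (H - θ * a : ℝ) * (H ^ 2 + a * θ * H + a ^ 2 * (θ ^ 2 - 12)) = (k / 2 : ℝ) ^ 2 := by
      linear_combination (-1 / 4) * hkR - a ^ 3 * h0
    by_contra hcon
    push Not at hcon
    nlinarith [sq_nonneg (k / 2 : ℝ)]
  have hA : (3 * a : ℝ) ≤ H ∧ (-3.5 * a : ℝ) ≤ H := by
    rcases le_total (0 : ℝ) a with ha | ha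
    · have hH : 0 < (H : ℝ) := by nlinarith
      refine ⟨?_, by linarith⟩
      by_contra hcon
      push Not at hcon
      have e1 : (H : ℝ) ^ 2 ≤ 3 * a * (3 * a) := by nlinarith
      have e2 : (a * θ * H : ℝ) ≤ a * θ * (3 * a) := by gcongr
      have ha_1 : 0 < (a : ℝ) ^ 2 := by nlinarith
      nlinarith
    · have hH : 0.34 * a ≤ (H : ℝ) := by nlinarith
      have hx : (-3.5 * a : ℝ) ≤ H := by
        by_contra hcon
        push Not at hcon
        have ha_1 : 0 < (a : ℝ) ^ 2 := by nlinarith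
        have e1 : ((H : ℝ) - 0.34 * a) * (H + 3.5 * a) ≤ 0 := by nlinarith
        have e2 : (0:ℝ) ≤ -a * (H - 0.34 * a) := by nlinarith
        have e3 : (0:ℝ) ≤ -a * (-3.5 * a - H) := by nlinarith
        nlinarith
      exact ⟨by linarith, hx⟩
  obtain ⟨hA1, hA2⟩ := hA
  have ha5 : a < 6 := by
    by_contra hcon
    have : (6 : ℝ) ≤ a := by exact_mod_cast not_lt.mp hcon
    nlinarith
  have ha4 : -5 < a := by
    by_contra hcon
    have : (a : ℝ) ≤ -5 := by exact_mod_cast not_lt.mp hcon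
    nlinarith
  have ha5R : (a : ℝ) ≤ 5 := by exact_mod_cast (by omega : a ≤ 5)
  have hH0 : 0 ≤ H := by
    have : (0 : ℝ) ≤ H := by
      rcases le_total (0 : ℝ) a with ha | ha <;> linarith
    exact_mod_cast this
  have hH17 : H < 18 := by
    have : (H : ℝ) < 18 := by nlinarith
    exact_mod_cast this
  have g1 : 3 * a ≤ H := by exact_mod_cast hA1
  have g2 : -7 * a ≤ 2 * H := by
    have : (-7 * a : ℝ) ≤ 2 * H := by linarith
    exact_mod_cast this
  refine finite_search a (Finset.mem_Icc.mpr ⟨by omega, by omega⟩) H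
    (Finset.mem_Icc.mpr ⟨by omega, by omega⟩) k.natAbs (Finset.mem_range.mpr ?_) ?_ g1 g2
  · have e1 : k ^ 2 < 150 ^ 2 := by
      have : H ^ 3 ≤ 17 ^ 3 := by gcongr; omega
      have : a ^ 3 ≤ 5 ^ 3 := by
        have : Monotone (fun t : ℤ => t ^ 3) := (Odd.strictMono_pow (by decide)).monotone
        exact this (by omega : a ≤ 5)
      nlinarith [mul_nonneg (sq_nonneg a) hH0]
    have := abs_lt_of_sq_lt_sq e1 (by norm_num)
    rw [Int.abs_eq_natAbs] at this
    exact_mod_cast this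
  · rw [Int.natCast_natAbs, sq_abs]; exact hk

/-- The binary quartic has a root at a primitive integral vector. -/
theorem exists_primitive_root (x y : ℤ) (hx : 4 ≤ x) (h : y ^ 2 = x ^ 3 - 12 * x + 4) :
    ∃ X Z : ℤ, IsCoprime Z X ∧
      X ^ 4 - 6 * x * X ^ 2 * Z ^ 2 + 8 * y * X * Z ^ 3 + (48 - 3 * x ^ 2) * Z ^ 4 = 0 := by
  obtain ⟨θ, h1, h2, h0⟩ := exists_theta
  have hxR : (4 : ℝ) ≤ x := by exact_mod_cast hx
  have hR : (y : ℝ) ^ 2 = x ^ 3 - 12 * x + 4 := by exact_mod_cast h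
  have ht : 0 < (x - θ : ℝ) := by linarith
  have hdisc : (x - θ : ℝ) * ((x - θ) * (x + 2 * θ)) - (-y) ^ 2
      = (x - θ) * (12 - 3 * θ ^ 2) := by
    linear_combination -hR - h0
  have hdpos : 0 < (x - θ : ℝ) * (12 - 3 * θ ^ 2) := mul_pos ht (by nlinarith)
  obtain ⟨m, n, k, l, hdet, hq0, hq⟩ := exists_short_vector (x - θ) (-y) ((x - θ) * (x + 2 * θ)) ht
    (by rw [hdisc]; exact hdpos)
  rw [hdisc] at hq
  set q : ℝ := (x - θ) * m ^ 2 + 2 * (-y) * m * n + (x - θ) * (x + 2 * θ) * n ^ 2 with hqdef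
  obtain ⟨a, ha⟩ : ∃ a, a = m ^ 4 - 6 * x * m ^ 2 * n ^ 2 + 8 * y * m * n ^ 3
    + (48 - 3 * x ^ 2) * n ^ 4 := ⟨_, rfl⟩
  obtain ⟨b, hb⟩ : ∃ b, b = m ^ 3 * k - 3 * x * (m * n ^ 2 * k + m ^ 2 * n * l)
    + 2 * y * (k * n ^ 3 + 3 * m * n ^ 2 * l) + (48 - 3 * x ^ 2) * n ^ 3 * l := ⟨_, rfl⟩
  obtain ⟨c, hc⟩ : ∃ c, c = m ^ 2 * k ^ 2 - x * (k ^ 2 * n ^ 2 + 4 * m * n * k * l + m ^ 2 * l ^ 2)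
    + 4 * y * (k * l * n ^ 2 + m * n * l ^ 2) + (48 - 3 * x ^ 2) * n ^ 2 * l ^ 2 := ⟨_, rfl⟩
  obtain ⟨d, hd⟩ : ∃ d, d = k ^ 3 * m - 3 * x * (k * l ^ 2 * m + k ^ 2 * l * n)
    + 2 * y * (m * l ^ 3 + 3 * k * l ^ 2 * n) + (48 - 3 * x ^ 2) * l ^ 3 * n := ⟨_, rfl⟩
  obtain ⟨e, he⟩ : ∃ e, e = k ^ 4 - 6 * x * k ^ 2 * l ^ 2 + 8 * y * k * l ^ 3
    + (48 - 3 * x ^ 2) * l ^ 4 := ⟨_, rfl⟩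
  obtain ⟨H, hH⟩ : ∃ H, H = x * m ^ 4 - 4 * y * m ^ 3 * n - (48 - 6 * x ^ 2) * m ^ 2 * n ^ 2
    - 4 * x * y * m * n ^ 3 + (x * (48 - 3 * x ^ 2) + 4 * y ^ 2) * n ^ 4 := ⟨_, rfl⟩
  have hHb : b ^ 2 - a * c = H := by
    have : b ^ 2 - a * c = H * (m * l - k * n) ^ 2 := by rw [ha, hb, hc, hH]; ring
    rw [this, hdet]; ring
  have hg2 : a * e - 4 * b * d + 3 * c ^ 2 = 48 := by
    have : a * e - 4 * b * d + 3 * c ^ 2 = 48 * (m * l - k * n) ^ 4 := by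
      rw [ha, hb, hc, hd, he]; ring
    rw [this, hdet]; ring
  have hg3 : a * c * e + 2 * b * c * d - a * d ^ 2 - b ^ 2 * e - c ^ 3 = -16 := by
    have : a * c * e + 2 * b * c * d - a * d ^ 2 - b ^ 2 * e - c ^ 3
        = (4 * x ^ 3 - 48 * x - 4 * y ^ 2) * (m * l - k * n) ^ 6 := by
      rw [ha, hb, hc, hd, he]; ring
    rw [this, hdet, h]; ring
  have hsyz : (a ^ 2 * d - 3 * a * b * c + 2 * b ^ 3) ^ 2
      = 4 * H ^ 3 - 48 * a ^ 2 * H + 16 * a ^ 3 := by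
    rw [← hHb]
    linear_combination -a ^ 2 * (b ^ 2 - a * c) * hg2 - a ^ 3 * hg3
  have haR : (a : ℝ) = m ^ 4 - 6 * x * m ^ 2 * n ^ 2 + 8 * y * m * n ^ 3
    + (48 - 3 * x ^ 2) * n ^ 4 := by rw [ha]; push_cast; ring
  have hHR : (H : ℝ) = x * m ^ 4 - 4 * y * m ^ 3 * n - (48 - 6 * x ^ 2) * m ^ 2 * n ^ 2
    - 4 * x * y * m * n ^ 3 + (x * (48 - 3 * x ^ 2) + 4 * y ^ 2) * n ^ 4 := by
    rw [hH]; push_cast; ring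
  have hqq : q ^ 2 = (x - θ) * (H - θ * a) := by
    rw [hqdef, haR, hHR]
    linear_combination (4 * (m : ℝ) ^ 2 * n ^ 2 - 4 * (x - θ) * n ^ 4) * (hR + h0)
  have hp : 0 < (H - θ * a : ℝ) := by
    have : 0 < (x - θ : ℝ) * (H - θ * a) := by rw [← hqq]; positivity
    exact (mul_pos_iff_of_pos_left ht).mp this
  have hp_1 : (H - θ * a : ℝ) ≤ 16 - 4 * θ ^ 2 := by
    rw [hqq] at hq
    have : (x - θ : ℝ) * (3 * (H - θ * a)) ≤ (x - θ) * (4 * (12 - 3 * θ ^ 2)) := by linarith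
    have := le_of_mul_le_mul_left this ht
    linarith
  -- a root of the reduced form gives a root of the original one
  have key : ∀ r : ℤ, a * r ^ 4 + 4 * b * r ^ 3 + 6 * c * r ^ 2 + 4 * d * r + e = 0 →
      ∃ X Z : ℤ, IsCoprime Z X ∧
      X ^ 4 - 6 * x * X ^ 2 * Z ^ 2 + 8 * y * X * Z ^ 3 + (48 - 3 * x ^ 2) * Z ^ 4 = 0 := by
    intro r hr
    refine ⟨m * r + k, n * r + l, ⟨m, -n, by linear_combination hdet⟩, ?_⟩
    rw [← hr, ha, hb, hc, hd, he]; ring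
  rcases pair_cases a H _ θ h1 h2 h0 hp hp_1 hsyz with hval1 | ⟨hval1, hval2⟩ | ⟨hval1, hval2⟩
  · exact ⟨m, n, ⟨-k, l, by linear_combination hdet⟩, by rw [← ha, hval1]⟩
  · have hc9 : c = b ^ 2 - 9 := by rw [hval1, hval2] at hHb; linarith
    rw [hval1, hval2, hc9] at hsyz
    rw [hval1, hc9] at hg2
    have hf : (d - 3 * b * (b ^ 2 - 9) + 2 * b ^ 3 - 50)
        * (d - 3 * b * (b ^ 2 - 9) + 2 * b ^ 3 + 50) = 0 := by linear_combination hsyz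
    have he_1 : e = 48 + 4 * b * d - 3 * (b ^ 2 - 9) ^ 2 := by linarith
    rcases mul_eq_zero.mp hf with hf | hf
    · have hd_1 : d = 50 + 3 * b * (b ^ 2 - 9) - 2 * b ^ 3 := by linarith
      apply key (3 - b)
      rw [hval1, he_1, hc9, hd_1]; ring
    · have hd_1 : d = -50 + 3 * b * (b ^ 2 - 9) - 2 * b ^ 3 := by linarith
      apply key (-3 - b)
      rw [hval1, he_1, hc9, hd_1]; ring
  · rw [hval1, hval2] at hHb
    have h3 : (3 : ℤ) ∣ b := by
      have : (3 : ℤ) ∣ b ^ 2 := ⟨4 - c, by linarith⟩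
      exact Int.prime_three.dvd_of_dvd_pow this
    obtain ⟨bThird, hb_1⟩ := h3
    have hc_1 : c = 4 - 3 * bThird ^ 2 := by rw [hb_1] at hHb; linarith
    rw [hval1, hb_1, hc_1] at hg2
    apply key bThird
    rw [hval1, hb_1, hc_1]
    linarith

/-- The doubling step: an integral half. -/
theorem half_point (a b r : ℤ) (h : b ^ 2 = a ^ 3 - 12 * a + 4)
    (hr : 2 * b * r = 3 * a ^ 2 - 12) : a = 0 := by
  have hdvd : b ^ 2 ∣ 2160 := by
    refine ⟨-(4 * r ^ 2 * (a ^ 2 - 16) - 9 * b ^ 2 + 72), ?_⟩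
    have e1 : b ^ 2 + 12 = (a - 2) ^ 2 * (a + 4) := by rw [h]; ring
    have e2 : b ^ 2 - 20 = (a + 2) ^ 2 * (a - 4) := by rw [h]; ring
    have e3 : (2 * b * r) ^ 2 * (a ^ 2 - 16) = 9 * ((b ^ 2 + 12) * (b ^ 2 - 20)) := by
      rw [hr, e1, e2]; ring
    linear_combination e3
  have hb : |b| < 47 := by
    have := Int.le_of_dvd (by norm_num) hdvd
    exact abs_lt_of_sq_lt_sq (by linarith) (by norm_num)
  have hb2 : b ^ 2 ≤ 2160 := Int.le_of_dvd (by norm_num) hdvd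
  have ha : a < 15 := by
    by_contra hc
    push Not at hc
    nlinarith [mul_nonneg (sub_nonneg.mpr hc) (sq_nonneg a)]
  have ha_1 : -4 < a := by
    by_contra hc
    push Not at hc
    nlinarith [sq_nonneg b, mul_nonneg (sub_nonneg.mpr hc) (sq_nonneg a)]
  have hdvd_1 : a ^ 3 - 12 * a + 4 ∣ 2160 := h ▸ hdvd
  have hnn : 0 ≤ a ^ 3 - 12 * a + 4 := h ▸ sq_nonneg b
  rw [abs_lt] at hb
  obtain ⟨hb3, hb4⟩ := hb
  clear hb2 hdvd hr
  interval_cases a <;> first | rfl | (exfalso; revert hdvd_1 hnn; decide) |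
    (exfalso; clear hdvd_1 hnn; interval_cases b <;> omega)

theorem integral_points_on_curve (x y : ℤ) (hy : 0 < y)
    (h : y ^ 2 = x ^ 3 - 12 * x + 4) :
    (x = 0 ∧ y = 2) ∨ (x = 9 ∧ y = 25) := by
  rcases lt_or_ge x 4 with hx | hx
  · have hx_1 : -4 < x := by
      by_contra hc
      push Not at hc
      nlinarith [sq_nonneg y, mul_nonneg (sub_nonneg.mpr hc) (sq_nonneg x)]
    have hy5 : y < 5 := by
      by_contra hc
      push Not at hc
      have : x ^ 3 - 12 * x + 4 < 25 := by interval_cases x <;> norm_num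
      nlinarith
    interval_cases x <;> interval_cases y <;> omega
  · obtain ⟨X, Z, hco, hF⟩ := exists_primitive_root x y hx h
    obtain ⟨r, hr⟩ : ∃ r : ℤ, r ^ 4 - 6 * x * r ^ 2 + 8 * y * r + (48 - 3 * x ^ 2) = 0 := by
      have hd : Z ∣ X ^ 4 :=
        ⟨6 * x * X ^ 2 * Z - 8 * y * X * Z ^ 2 - (48 - 3 * x ^ 2) * Z ^ 3, by linarith⟩
      have hu : IsUnit Z := (hco.pow_right (n := 4)).isUnit_of_dvd' dvd_rfl hd
      rcases Int.isUnit_iff.mp hu with hZ | hZ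
      · exact ⟨X, by rw [hZ] at hF; linarith⟩
      · exact ⟨-X, by rw [hZ] at hF; linarith⟩
    have hpar : (2 : ℤ) ∣ r ^ 2 - x := by
      have h4 : (2 : ℤ) ∣ r ^ 4 - 3 * x ^ 2 := ⟨3 * x * r ^ 2 - 4 * y * r - 24, by linarith⟩
      have : (r ^ 2 - x) % 2 = 0 ∨ (r ^ 4 - 3 * x ^ 2) % 2 ≠ 0 := by
        rcases Int.emod_two_eq_zero_or_one r with h1 | h1 <;>
        rcases Int.emod_two_eq_zero_or_one x with h2 | h2 <;>
        simp [pow_succ, Int.sub_emod, Int.mul_emod, h1, h2]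
      omega
    obtain ⟨a, ha⟩ := hpar
    have hxa : x = r ^ 2 - 2 * a := by linarith
    have hr0 : 2 * (y - r * (x - a)) * r = 3 * a ^ 2 - 12 := by
      have : 4 * (2 * (y - r * (x - a)) * r) = 4 * (3 * a ^ 2 - 12) := by
        rw [hxa] at hr ⊢
        linear_combination hr
      linarith
    have hb : (y - r * (x - a)) ^ 2 = a ^ 3 - 12 * a + 4 := by
      rw [hxa] at h hr0 ⊢
      linear_combination h - (r ^ 2 - 3 * a) * hr0
    have ha0 := half_point a _ r hb hr0
    subst ha0
    have hx2 : x = r ^ 2 := by linarith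
    have hb2 : (y - r * x - 2) * (y - r * x + 2) = 0 := by linear_combination hb
    have hr1 : (y - r * x) * r = -6 := by linarith
    right
    rcases mul_eq_zero.mp hb2 with h3 | h3
    · have : y - r * x = 2 := by linarith
      rw [this] at hr1
      have : r = -3 := by linarith
      subst this
      exfalso
      have : x = 9 := by linarith
      subst this
      linarith
    · have : y - r * x = -2 := by linarith
      rw [this] at hr1
      have : r = 3 := by linarith
      subst this
      have : x = 9 := by linarith
      subst this
      exact ⟨rfl, by linarith⟩
end

section
/- Let λ and μ be partitions with μ ⊆ λ, and let p be a prime. The number of subgroups of type μ in a finite abelian p-group of type λ equals ∏_{j≥1} p^{μ'_j(λ'_j - μ'_j)} · binom(λ'_j - μ'_{j+1}, λ'_j - μ'_j)_{p^{-1}}, where λ', μ' are the conjugate partitions and binom(·,·)_{p^{-1}} is the Gaussian binomial at p^{-1}. -/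
/-- Gaussian binomial coefficient `binom(a,b)_q = ∏_{i=0}^{b-1} (q^a - q^i)/(q^b - q^i)`. -/
def gbinomQ (q : ℚ) (a b : ℕ) : ℚ :=
  ∏ i ∈ Finset.range b, (q ^ a - q ^ i) / (q ^ b - q ^ i)

/-- The conjugate partition: `conj λ j = #{i : λ i ≥ j}`. -/
def conjPart {n : ℕ} (lam : Fin n → ℕ) (j : ℕ) : ℕ :=
  (Finset.univ.filter fun i => j ≤ lam i).card

namespace HallCount

/-- number of injective homs -/
noncomputable def injN (A G : Type) [AddCommGroup A] [AddCommGroup G] : ℕ :=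
  Nat.card {f : A →+ G // Function.Injective f}

/-- size of `N`-torsion -/
noncomputable def tor (G : Type) [AddCommGroup G] (N : ℕ) : ℕ :=
  Nat.card {x : G // N • x = 0}

lemma injN_congr {A B G : Type} [AddCommGroup A] [AddCommGroup B] [AddCommGroup G]
    (e : A ≃+ B) : injN A G = injN B G := by
  refine Nat.card_congr
    { toFun := fun f => ⟨f.1.comp e.symm.toAddMonoidHom, f.2.comp e.symm.injective⟩
      invFun := fun f => ⟨f.1.comp e.toAddMonoidHom, f.2.comp e.injective⟩
      left_inv := ?_
      right_inv := ?_ }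
  · intro f; ext x; simp
  · intro f; ext x; simp

lemma injN_self {A : Type} [AddCommGroup A] [Finite A] : injN A A = Nat.card (A ≃+ A) := by
  refine Nat.card_congr
    { toFun := fun f => AddEquiv.ofBijective f.1 (Finite.injective_iff_bijective.1 f.2)
      invFun := fun e => ⟨e.toAddMonoidHom, e.injective⟩
      left_inv := ?_
      right_inv := ?_ }
  · intro f; ext x; simp
  · intro f; ext x; simp

lemma card_sub_mul {A G : Type} [AddCommGroup A] [AddCommGroup G] [Finite A] [Finite G] :
    Nat.card {H : AddSubgroup G // Nonempty (H ≃+ A)} * injN A A = injN A G := by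
  classical
  have key : injN A G = Nat.card (Σ H : {H : AddSubgroup G // Nonempty (H ≃+ A)}, (A ≃+ H.1)) := by
    symm
    refine Nat.card_eq_of_bijective
      (fun s => (⟨s.1.1.subtype.comp s.2.toAddMonoidHom,
        s.1.1.subtype_injective.comp s.2.injective⟩ : {f : A →+ G // Function.Injective f})) ⟨?_, ?_⟩
    · rintro ⟨⟨H, hH⟩, e⟩ ⟨⟨K, hK⟩, e'⟩ h
      have h1 : ∀ x, ((e x : H) : G) = (e' x : K) := fun x =>
        DFunLike.congr_fun (congrArg Subtype.val h) x
      have hHK : H = K := by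
        ext g
        constructor
        · intro hg
          have := h1 (e.symm ⟨g, hg⟩)
          simp at this
          rw [this]; exact SetLike.coe_mem _
        · intro hg
          have := h1 (e'.symm ⟨g, hg⟩)
          simp at this
          rw [← this]; exact SetLike.coe_mem _
      subst hHK
      have : e = e' := by
        ext x; exact h1 x
      subst this
      rfl
    · rintro ⟨f, hf⟩
      refine ⟨⟨⟨f.range, ⟨(AddMonoidHom.ofInjective hf).symm⟩⟩, AddMonoidHom.ofInjective hf⟩, ?_⟩
      ext x; rfl
  have hc : ∀ H : {H : AddSubgroup G // Nonempty (H ≃+ A)}, Nat.card (A ≃+ H.1) = injN A A := by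
    rintro ⟨H, ⟨e⟩⟩
    rw [injN_self]
    refine Nat.card_congr
      { toFun := fun f => f.trans e
        invFun := fun f => f.trans e.symm
        left_inv := ?_
        right_inv := ?_ }
    · intro f; ext x; simp
    · intro f; ext x; simp
  have fin : ∀ H : {H : AddSubgroup G // Nonempty (H ≃+ A)}, Finite (A ≃+ H.1) := fun H =>
    DFunLike.finite _
  have : Fintype {H : AddSubgroup G // Nonempty (H ≃+ A)} := Fintype.ofFinite _
  rw [key, Nat.card_sigma, Finset.sum_congr rfl (fun H _ => hc H)]
  simp

lemma card_pre {A G : Type} [AddCommGroup A] [AddCommGroup G] [Finite A] [Finite G]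
    (p k : ℕ) (hA : ∀ a : A, p • a = 0 → ∃ b : A, p ^ k • b = a) (f : A →+ G)
    (hf : Function.Injective f) :
    Nat.card {x : G // p ^ (k + 1) • x = 0 ∧ p ^ k • x ∈ f.range} = tor A p * tor G (p ^ k) := by
  rw [tor, tor, ← Nat.card_prod]
  symm
  choose b hb using hA
  refine Nat.card_eq_of_bijective (fun s => ⟨f (b s.1.1 s.1.2) + s.2.1, ?_, ?_⟩) ⟨?_, ?_⟩
  · obtain ⟨⟨a, ha⟩, ⟨y, hy⟩⟩ := s
    rw [pow_succ', mul_smul, smul_add, hy, ← map_nsmul, hb, add_zero, ← map_nsmul, ha, map_zero]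
  · obtain ⟨⟨a, ha⟩, ⟨y, hy⟩⟩ := s
    rw [smul_add, hy, ← map_nsmul, hb, add_zero]
    exact ⟨a, rfl⟩
  · rintro ⟨⟨a, ha⟩, ⟨y, hy⟩⟩ ⟨⟨a', ha'⟩, ⟨y', hy'⟩⟩ h
    have h := congrArg Subtype.val h
    simp only at h
    have h2 := congrArg (fun z => p ^ k • z) h
    simp only [smul_add, hy, hy', ← map_nsmul, hb, add_zero] at h2
    have := hf h2
    subst this
    simpa using h
  · rintro ⟨x, hx, ⟨a, ha⟩⟩
    have hpa : p • a = 0 := by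
      apply hf
      rw [map_nsmul, ha, ← mul_smul, ← pow_succ', hx, map_zero]
    refine ⟨⟨⟨a, hpa⟩, ⟨x - f (b a hpa), ?_⟩⟩, ?_⟩
    · rw [smul_sub, ← map_nsmul, hb, ha, sub_self]
    · simp

lemma coprod_inj {A G : Type} [AddCommGroup A] [AddCommGroup G]
    (p k : ℕ) (hp : p.Prime) (F : A × ZMod (p ^ (k + 1)) →+ G) :
    Function.Injective F ↔ Function.Injective (F.comp (AddMonoidHom.inl _ _)) ∧
      p ^ k • F (0, 1) ∉ (F.comp (AddMonoidHom.inl A (ZMod (p ^ (k + 1))))).range := by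
  constructor
  · intro h
    refine ⟨h.comp (fun a b hab => by simpa using hab), ?_⟩
    rintro ⟨a, ha⟩
    rw [← map_nsmul] at ha
    have := h ha
    simp only [AddMonoidHom.inl_apply, Prod.smul_mk, Prod.mk.injEq, smul_zero] at this
    have h3 := this.2
    rw [nsmul_one, eq_comm, ZMod.natCast_eq_zero_iff, Nat.pow_dvd_pow_iff_le_right hp.one_lt] at h3
    omega
  · rintro ⟨h1, h2⟩
    rw [injective_iff_map_eq_zero]
    rintro ⟨a, t⟩ h
    have : NeZero (p ^ (k + 1)) := ⟨(pow_pos hp.pos _).ne'⟩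
    obtain ⟨t, rfl⟩ : ∃ t' : ℕ, (t' : ZMod (p ^ (k + 1))) = t := ⟨t.val, by simp⟩
    have hs : F (a, (t : ZMod (p ^ (k + 1)))) = F (a, 0) + t • F (0, 1) := by
      rw [← map_nsmul, ← map_add]; simp
    rw [hs] at h
    by_cases ht : (t : ZMod (p ^ (k + 1))) = 0
    · rw [← hs, ht] at h
      have : a = 0 := h1 (by simpa [← Prod.zero_eq_mk] using h)
      simp [this, ht]
    · exfalso
      rw [ZMod.natCast_eq_zero_iff] at ht
      have h0 : p ^ (k + 1) • F (0, 1) = 0 := by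
        rw [← map_nsmul]
        have : p ^ (k + 1) • ((0 : A), (1 : ZMod (p ^ (k + 1)))) = 0 := by
          ext
          · simp
          · simp only [Prod.smul_mk, nsmul_one, ZMod.natCast_self, Prod.snd_zero]
        rw [this, map_zero]
      have hg : Nat.gcd t (p ^ (k + 1)) ∣ p ^ k := by
        obtain ⟨m, hm, he⟩ := (Nat.dvd_prime_pow hp).1 (Nat.gcd_dvd_right t (p ^ (k + 1)))
        rw [he]
        apply pow_dvd_pow
        by_contra hk
        have : m = k + 1 := by omega
        subst this
        exact ht (he ▸ Nat.gcd_dvd_left _ _)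
      obtain ⟨c, hc⟩ := hg
      apply h2
      have hz : ((p ^ k : ℕ) : ℤ) = (t : ℤ) * (Nat.gcdA t (p ^ (k + 1)) * c) +
          ((p ^ (k + 1) : ℕ) : ℤ) * (Nat.gcdB t (p ^ (k + 1)) * c) := by
        have := Nat.gcd_eq_gcd_ab t (p ^ (k + 1))
        rw [hc, Nat.cast_mul, this]; ring
      have h4 : p ^ k • F (0, 1) = (Nat.gcdA t (p ^ (k + 1)) * c) • (t • F (0, 1)) := by
        rw [← natCast_zsmul, hz, add_smul, mul_comm, mul_smul, natCast_zsmul, mul_comm (((p ^ (k + 1) : ℕ) : ℤ)),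
          mul_smul _ ((p ^ (k + 1) : ℕ) : ℤ), natCast_zsmul, h0, smul_zero, add_zero]
      rw [h4, ← neg_eq_of_add_eq_zero_right h]
      exact AddSubgroup.zsmul_mem _ (AddSubgroup.neg_mem _ (AddMonoidHom.mem_range.2 ⟨a, rfl⟩)) _

lemma injN_prod {A G : Type} [AddCommGroup A] [AddCommGroup G] [Finite A] [Finite G]
    (p k : ℕ) (hp : p.Prime) (hA : ∀ a : A, p • a = 0 → ∃ b : A, p ^ k • b = a) :
    (injN (A × ZMod (p ^ (k + 1))) G : ℚ) =
      injN A G * (tor G (p ^ (k + 1)) - tor A p * tor G (p ^ k)) := by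
  classical
  have key : injN (A × ZMod (p ^ (k + 1))) G =
      Nat.card (Σ f : {f : A →+ G // Function.Injective f},
        {x : G // p ^ (k + 1) • x = 0 ∧ p ^ k • x ∉ f.1.range}) := by
    refine Nat.card_eq_of_bijective (fun F => ⟨⟨F.1.comp (AddMonoidHom.inl _ _),
      ((coprod_inj p k hp F.1).1 F.2).1⟩, ⟨F.1 (0, 1), ?_, ((coprod_inj p k hp F.1).1 F.2).2⟩⟩) ⟨?_, ?_⟩
    · rw [← map_nsmul]
      have : p ^ (k + 1) • ((0 : A), (1 : ZMod (p ^ (k + 1)))) = 0 := by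
        ext
        · simp
        · simp only [Prod.smul_mk, nsmul_one, ZMod.natCast_self, Prod.snd_zero]
      rw [this, map_zero]
    · rintro ⟨F, hF⟩ ⟨F', hF'⟩ h
      rw [Sigma.mk.injEq] at h
      obtain ⟨ha, hb⟩ := h
      have ha' := congrArg Subtype.val ha
      simp only at ha'
      have hb' : F (0, 1) = F' (0, 1) := by
        have : ∀ (f g : {f : A →+ G // Function.Injective f}) (_ : f = g)
          (x : {x : G // p ^ (k + 1) • x = 0 ∧ p ^ k • x ∉ f.1.range})
          (y : {x : G // p ^ (k + 1) • x = 0 ∧ p ^ k • x ∉ g.1.range}), x ≍ y → x.1 = y.1 := by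
          rintro f g rfl x y h
          rw [eq_of_heq h]
        exact this _ _ ha _ _ hb
      have : NeZero (p ^ (k + 1)) := ⟨(pow_pos hp.pos _).ne'⟩
      congr 1
      ext ⟨a, t⟩
      obtain ⟨t, rfl⟩ : ∃ t' : ℕ, (t' : ZMod (p ^ (k + 1))) = t := ⟨t.val, by simp⟩
      have hs : ∀ F : A × ZMod (p ^ (k + 1)) →+ G,
          F (a, (t : ZMod (p ^ (k + 1)))) = F (a, 0) + t • F (0, 1) := by
        intro F
        rw [← map_nsmul, ← map_add]; simp
      rw [hs, hs, hb']
      congr 1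
      exact DFunLike.congr_fun ha' a
    · rintro ⟨⟨f, hf⟩, ⟨x, hx, hx'⟩⟩
      let l : ZMod (p ^ (k + 1)) →+ G := ZMod.lift (p ^ (k + 1))
        ⟨zmultiplesHom G x, by
          rw [zmultiplesHom_apply, natCast_zsmul, hx]⟩
      have hl : l 1 = x := by
        have := ZMod.lift_coe (p ^ (k + 1)) (⟨zmultiplesHom G x, by
          rw [zmultiplesHom_apply, natCast_zsmul, hx]⟩ : {f : ℤ →+ G // f ((p ^ (k + 1) : ℕ) : ℤ) = 0}) 1
        simpa using this
      have e1 : (f.coprod l).comp (AddMonoidHom.inl _ _) = f := by ext; simp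
      have e2 : (f.coprod l) (0, 1) = x := by simp [hl]
      have hF : Function.Injective (f.coprod l) := by
        rw [coprod_inj p k hp, e1, e2]
        exact ⟨hf, hx'⟩
      refine ⟨⟨f.coprod l, hF⟩, ?_⟩
      have : ∀ (f g : {f : A →+ G // Function.Injective f}) (_ : f = g)
          (x : {x : G // p ^ (k + 1) • x = 0 ∧ p ^ k • x ∉ f.1.range})
          (y : {x : G // p ^ (k + 1) • x = 0 ∧ p ^ k • x ∉ g.1.range}), x.1 = y.1 → 
          (⟨f, x⟩ : Σ f : {f : A →+ G // Function.Injective f},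
        {x : G // p ^ (k + 1) • x = 0 ∧ p ^ k • x ∉ f.1.range}) = ⟨g, y⟩ := by
        rintro f g rfl x y h
        rw [Subtype.ext h]
      apply this
      · exact Subtype.ext e1
      · exact e2
  have hfib : ∀ f : {f : A →+ G // Function.Injective f},
      (Nat.card {x : G // p ^ (k + 1) • x = 0 ∧ p ^ k • x ∉ f.1.range} : ℚ) =
        tor G (p ^ (k + 1)) - tor A p * tor G (p ^ k) := by
    intro f
    have := card_pre p k hA f.1 f.2
    rw [eq_sub_iff_add_eq, ← Nat.cast_mul, ← this, ← Nat.cast_add, tor]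
    congr 1
    rw [← Nat.card_sum]
    symm
    have e := (Equiv.sumCompl (fun x : {x : G // p ^ (k + 1) • x = 0} => p ^ k • x.1 ∈ f.1.range)).symm
    refine Nat.card_congr (e.trans ((Equiv.sumComm _ _).trans (Equiv.sumCongr ?_ ?_)))
    · exact Equiv.subtypeSubtypeEquivSubtypeInter (fun x : G => p ^ (k + 1) • x = 0) (fun x => p ^ k • x ∉ f.1.range)
    · exact Equiv.subtypeSubtypeEquivSubtypeInter (fun x : G => p ^ (k + 1) • x = 0) (fun x => p ^ k • x ∈ f.1.range)
  have : Finite (A →+ G) := DFunLike.finite _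
  have : Fintype {f : A →+ G // Function.Injective f} := Fintype.ofFinite _
  rw [key, Nat.card_sigma, Nat.cast_sum, Finset.sum_congr rfl (fun f _ => hfib f)]
  rw [Finset.sum_const, nsmul_eq_mul, Finset.card_univ, ← Nat.card_eq_fintype_card]
  rfl

end HallCount

namespace HallCount

lemma prod_shift (p : ℚ) (e d : ℕ) :
    (∏ i ∈ Finset.range d, (p ^ (d + e - i) - 1)) * ∏ s ∈ Finset.range e, (p ^ (s + 1) - 1) =
      ∏ s ∈ Finset.range (e + d), (p ^ (s + 1) - 1) := by
  rw [Finset.prod_range_add, mul_comm]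
  congr 1
  rw [← Finset.prod_range_reflect]
  apply Finset.prod_congr rfl
  intro i hi
  rw [Finset.mem_range] at hi
  congr 2
  omega

lemma Qpos (p : ℚ) (hp : 1 < p) (e : ℕ) : ∏ s ∈ Finset.range e, (p ^ (s + 1) - 1) ≠ 0 := by
  rw [Finset.prod_ne_zero_iff]
  intro i _
  have := one_lt_pow₀ hp (Nat.succ_ne_zero i)
  exact sub_ne_zero.2 this.ne'

lemma gb_inv (p : ℚ) (hp : 1 < p) (d e : ℕ) :
    p ^ (e * d) * gbinomQ p⁻¹ (d + e) d =
      ∏ i ∈ Finset.range d, (p ^ (d + e - i) - 1) / (p ^ (d - i) - 1) := by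
  have hp0 : p ≠ 0 := by positivity
  rw [gbinomQ, pow_mul, Finset.pow_eq_prod_const, ← Finset.prod_mul_distrib]
  apply Finset.prod_congr rfl
  intro i hi
  rw [Finset.mem_range] at hi
  obtain ⟨c, rfl⟩ : ∃ c, d = i + 1 + c := ⟨d - i - 1, by omega⟩
  have h1 : i + 1 + c + e - i = c + e + 1 := by omega
  have h2 : i + 1 + c - i = c + 1 := by omega
  rw [h1, h2]
  have h3 : p ^ (c + 1) - 1 ≠ 0 := sub_ne_zero.2 (one_lt_pow₀ hp (Nat.succ_ne_zero c)).ne'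
  have h4 : p⁻¹ ^ (i + 1 + c) - p⁻¹ ^ i ≠ 0 := by
    have : p⁻¹ ^ (i + 1 + c) - p⁻¹ ^ i = - (p⁻¹ ^ (i + 1 + c) * (p ^ (c + 1) - 1)) := by
      rw [mul_sub, show i + 1 + c = i + (c + 1) by ring, pow_add, inv_pow, inv_pow]
      field_simp
      ring
    rw [this]
    have := mul_ne_zero (pow_ne_zero (i + 1 + c) (inv_ne_zero hp0)) h3
    exact neg_ne_zero.2 this
  rw [mul_div_assoc', div_eq_div_iff h4 h3]
  simp only [inv_pow]
  field_simp
  ring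

lemma gb_p (p : ℚ) (hp : 1 < p) (l m m' : ℕ) (h1 : m' ≤ m) (h2 : m ≤ l) :
    ∏ i ∈ Finset.Ico m' m, (p ^ l - p ^ i) / (p ^ m - p ^ i) =
      ∏ i ∈ Finset.range (m - m'), (p ^ ((m - m') + (l - m) - i) - 1) / (p ^ (m - m' - i) - 1) := by
  have hp0 : p ≠ 0 := by positivity
  rw [Finset.prod_Ico_eq_prod_range]
  apply Finset.prod_congr rfl
  intro i hi
  rw [Finset.mem_range] at hi
  have e1 : p ^ l = p ^ (m' + i) * p ^ (m - m' + (l - m) - i) := by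
    rw [← pow_add]; congr 1; omega
  have e2 : p ^ m = p ^ (m' + i) * p ^ (m - m' - i) := by
    rw [← pow_add]; congr 1; omega
  rw [e1, e2, ← mul_sub_one, ← mul_sub_one, mul_div_mul_left _ _ (pow_ne_zero _ hp0)]

lemma core (p : ℚ) (hp : 1 < p) (l m m' : ℕ) (h1 : m' ≤ m) (h2 : m ≤ l) :
    p ^ (m * (l - m)) * gbinomQ p⁻¹ (l - m') (l - m) =
      p ^ (m' * (l - m)) * ∏ i ∈ Finset.Ico m' m, (p ^ l - p ^ i) / (p ^ m - p ^ i) := by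
  have h3 := gb_inv p hp (l - m) (m - m')
  have e : l - m + (m - m') = l - m' := by omega
  have sym : ∏ i ∈ Finset.range (l - m), (p ^ (l - m + (m - m') - i) - 1) / (p ^ (l - m - i) - 1)
      = ∏ i ∈ Finset.range (m - m'), (p ^ ((m - m') + (l - m) - i) - 1) / (p ^ (m - m' - i) - 1) := by
    rw [Finset.prod_div_distrib, Finset.prod_div_distrib]
    generalize l - m = d
    generalize m - m' = e
    have a1 := prod_shift p e d
    have a2 := prod_shift p d e
    have a3 := prod_shift p 0 d
    have a4 := prod_shift p 0 e
    simp only [add_zero, zero_add, Finset.prod_range_zero, mul_one] at a3 a4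
    rw [a3, a4, div_eq_div_iff (Qpos p hp d) (Qpos p hp e), a1, a2, add_comm]
  rw [gb_p p hp l m m' h1 h2, ← sym, ← h3, e, ← mul_assoc, ← pow_add, ← add_mul]
  congr 3
  omega

lemma telescoping (p : ℚ) (hp : 1 < p) (l m : ℕ → ℕ) (hm : Antitone m) (hml : ∀ j, m j ≤ l j)
    (r : ℕ → ℚ) (hr : ∀ j i, m (j + 2) ≤ i → i < m (j + 1) →
      r i = p ^ (∑ t ∈ Finset.Icc 1 j, (l t - m t)) * ((p ^ l (j + 1) - p ^ i) / (p ^ m (j + 1) - p ^ i)))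
    (J : ℕ) :
    ∏ j ∈ Finset.Icc 1 J, (p ^ (m j * (l j - m j)) * gbinomQ p⁻¹ (l j - m (j + 1)) (l j - m j)) =
      (∏ i ∈ Finset.Ico (m (J + 1)) (m 1), r i) *
        p ^ (m (J + 1) * ∑ t ∈ Finset.Icc 1 J, (l t - m t)) := by
  induction J with
  | zero => simp
  | succ J ih =>
    rw [Finset.prod_Icc_succ_top (by omega), ih, core p hp _ _ _ (hm (by omega)) (hml _),
      ← Finset.prod_Ico_consecutive r (hm (show J + 1 ≤ J + 1 + 1 by omega)) (hm (show 1 ≤ J + 1 by omega)),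
      Finset.sum_Icc_succ_top (by omega)]
    have : ∏ i ∈ Finset.Ico (m (J + 1 + 1)) (m (J + 1)), r i =
        (p ^ ((m (J + 1) - m (J + 1 + 1)) * ∑ t ∈ Finset.Icc 1 J, (l t - m t))) *
         ∏ i ∈ Finset.Ico (m (J + 1 + 1)) (m (J + 1)), ((p ^ l (J + 1) - p ^ i) / (p ^ m (J + 1) - p ^ i)) := by
      rw [Finset.prod_congr rfl (fun i hi => hr J i (Finset.mem_Ico.1 hi).1 (Finset.mem_Ico.1 hi).2),
        Finset.prod_mul_distrib, Finset.prod_const, Nat.card_Ico, ← pow_mul, mul_comm (m (J + 1) - _)]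
    rw [this]
    have h := hm (show J + 1 ≤ J + 1 + 1 by omega)
    obtain ⟨c, hc⟩ := Nat.exists_eq_add_of_le h
    rw [hc, Nat.add_sub_cancel_left]
    ring

end HallCount

namespace HallCount

lemma tor_zmod (p : ℕ) (hp : p.Prime) (l k : ℕ) : tor (ZMod (p ^ l)) (p ^ k) = p ^ min l k := by
  have : NeZero (p ^ l) := ⟨(pow_pos hp.pos _).ne'⟩
  have h := IsAddCyclic.card_nsmulAddMonoidHom_ker (ZMod (p ^ l)) (p ^ k)
  rw [Nat.card_zmod] at h
  have h2 : Nat.gcd (p ^ l) (p ^ k) = p ^ min l k := by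
    rcases le_total l k with hlk | hlk
    · rw [min_eq_left hlk, Nat.gcd_eq_left (pow_dvd_pow _ hlk)]
    · rw [min_eq_right hlk, Nat.gcd_eq_right (pow_dvd_pow _ hlk)]
  rw [← h2, ← h]
  exact Nat.card_congr (Equiv.subtypeEquivRight fun x => by simp [AddMonoidHom.mem_ker])

lemma tor_pi (p : ℕ) (hp : p.Prime) {n : ℕ} (lam : Fin n → ℕ) (k : ℕ) :
    tor (∀ i : Fin n, ZMod (p ^ lam i)) (p ^ k) = p ^ ∑ i, min (lam i) k := by
  rw [← Finset.prod_pow_eq_pow_sum, ← Finset.prod_congr rfl (fun i _ => tor_zmod p hp (lam i) k)]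
  unfold tor
  rw [← Nat.card_pi]
  refine Nat.card_congr (Equiv.trans (Equiv.subtypeEquivRight fun x => ?_) Equiv.subtypePiEquivPi)
  rw [funext_iff]
  rfl

lemma sum_min {n : ℕ} (lam : Fin n → ℕ) (k : ℕ) :
    ∑ i, min (lam i) k = ∑ j ∈ Finset.Icc 1 k, conjPart lam j := by
  simp only [conjPart, Finset.card_filter]
  rw [Finset.sum_comm]
  apply Finset.sum_congr rfl
  intro i _
  rw [← Finset.card_filter]
  have : Finset.filter (fun j => j ≤ lam i) (Finset.Icc 1 k) = Finset.Icc 1 (min (lam i) k) := by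
    ext j; simp only [Finset.mem_filter, Finset.mem_Icc, le_min_iff]; tauto
  rw [this]; simp

lemma zmod_div (p : ℕ) (hp : p.Prime) (l k : ℕ) (hk : k + 1 ≤ l) (a : ZMod (p ^ l)) (ha : p • a = 0) :
    ∃ b : ZMod (p ^ l), p ^ k • b = a := by
  have : NeZero (p ^ l) := ⟨(pow_pos hp.pos _).ne'⟩
  obtain ⟨t, rfl⟩ : ∃ t' : ℕ, (t' : ZMod (p ^ l)) = a := ⟨a.val, by simp⟩
  rw [nsmul_eq_mul, ← Nat.cast_mul, ZMod.natCast_eq_zero_iff] at ha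
  obtain ⟨c, rfl⟩ := Nat.exists_eq_add_of_le hk
  have : p ^ k ∣ t := by
    apply Nat.dvd_of_mul_dvd_mul_left hp.pos
    refine dvd_trans ?_ ha
    rw [← pow_succ']
    exact pow_dvd_pow _ (by omega)
  obtain ⟨s, rfl⟩ := this
  exact ⟨s, by rw [nsmul_eq_mul]; push_cast; rfl⟩

/-- splitting the last coordinate -/
def splitLast (p : ℕ) (nu : ℕ → ℕ) (m : ℕ) :
    (∀ i : Fin (m + 1), ZMod (p ^ nu i)) ≃+ (∀ i : Fin m, ZMod (p ^ nu i)) × ZMod (p ^ nu m) where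
  toFun x := (fun i => x i.castSucc, x (Fin.last m))
  invFun y := Fin.snoc (α := fun i : Fin (m + 1) => ZMod (p ^ nu i)) y.1 y.2
  left_inv x := Fin.snoc_init_self (α := fun i : Fin (m + 1) => ZMod (p ^ nu i)) x
  right_inv y := by
    ext
    · exact Fin.snoc_castSucc (α := fun i : Fin (m + 1) => ZMod (p ^ nu i)) _ _ _
    · exact Fin.snoc_last (α := fun i : Fin (m + 1) => ZMod (p ^ nu i)) _ _
  map_add' x y := rfl

lemma injN_pi (p : ℕ) (hp : p.Prime) (nu : ℕ → ℕ) (hnu : Antitone nu)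
    (G : Type) [AddCommGroup G] [Finite G] (m : ℕ) :
    (injN (∀ i : Fin m, ZMod (p ^ nu i)) G : ℚ) = ∏ i ∈ Finset.range m,
      if nu i = 0 then 1 else
        ((tor G (p ^ nu i) : ℚ) - (p : ℚ) ^ i * tor G (p ^ (nu i - 1))) := by
  have fin : ∀ l : ℕ, NeZero (p ^ l) := fun l => ⟨(pow_pos hp.pos _).ne'⟩
  induction m with
  | zero =>
    simp only [Finset.range_zero, Finset.prod_empty]
    have : injN (∀ i : Fin 0, ZMod (p ^ nu i)) G = 1 := by
      rw [injN, Nat.card_eq_one_iff_unique]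
      constructor
      · constructor
        rintro ⟨f, hf⟩ ⟨g, hg⟩
        congr 1
        apply DFunLike.ext
        intro x
        have hx : x = 0 := Subsingleton.elim _ _
        rw [hx, map_zero, map_zero]
      · exact ⟨⟨0, Function.injective_of_subsingleton _⟩⟩
    rw [this, Nat.cast_one]
  | succ m ih =>
    rw [injN_congr (splitLast p nu m), Finset.prod_range_succ, ← ih]
    by_cases h : nu m = 0
    · rw [if_pos h, mul_one]
      have : Unique (ZMod (p ^ nu m)) := by
        rw [h, pow_zero]
        infer_instance
      rw [injN_congr (AddEquiv.prodUnique)]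
    · rw [if_neg h]
      obtain ⟨k, hk⟩ := Nat.exists_eq_succ_of_ne_zero h
      rw [hk, Nat.succ_eq_add_one, Nat.add_sub_cancel]
      have hle : ∀ i : Fin m, k + 1 ≤ nu i := fun i => by
        have := hnu i.2.le
        omega
      rw [injN_prod p k hp]
      · have : tor (∀ i : Fin m, ZMod (p ^ nu i)) p = p ^ m := by
          have := tor_pi p hp (fun i : Fin m => nu i) 1
          rw [pow_one] at this
          rw [this]
          congr 1
          rw [Finset.sum_congr rfl (fun (i : Fin m) _ => min_eq_right (show 1 ≤ nu i from by have := hle i; omega))]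
          simp
        rw [this]
        push_cast
        rfl
      · intro a ha
        have : ∀ i : Fin m, ∃ b : ZMod (p ^ nu i), p ^ k • b = a i := fun i =>
          zmod_div p hp _ k (hle i) (a i) (congrFun ha i)
        choose b hb using this
        exact ⟨b, funext hb⟩

lemma exists_sorted {n : ℕ} (mu : Fin n → ℕ) : ∃ (nu : ℕ → ℕ) (s : Equiv.Perm (Fin n)),
    Antitone nu ∧ (∀ i : Fin n, nu i = mu (s i)) ∧ ∀ i, n ≤ i → nu i = 0 := by
  refine ⟨fun i => if h : i < n then mu (Tuple.sort mu (Fin.rev ⟨i, h⟩)) else 0,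
    Fin.revPerm.trans (Tuple.sort mu), ?_, ?_, ?_⟩
  · intro i j hij
    by_cases hj : j < n
    · have hi : i < n := by omega
      simp only [hi, hj, dif_pos]
      apply Tuple.monotone_sort mu
      rw [Fin.rev_le_rev]
      exact hij
    · simp [hj]
  · intro i
    simp
  · intro i hi
    simp [hi]

lemma le_iff_lt_conj {n : ℕ} (mu : Fin n → ℕ) (nu : ℕ → ℕ) (s : Equiv.Perm (Fin n))
    (h1 : Antitone nu) (h2 : ∀ i : Fin n, nu i = mu (s i)) (h3 : ∀ i, n ≤ i → nu i = 0)
    (j : ℕ) (hj : 1 ≤ j) (i : ℕ) : j ≤ nu i ↔ i < conjPart mu j := by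
  have e : conjPart mu j = ((Finset.range n).filter fun i => j ≤ nu i).card := by
    rw [conjPart, Finset.card_filter, Finset.card_filter, Finset.sum_range, ← Equiv.sum_comp s]
    simp only [h2]
  rw [e]
  constructor
  · intro h
    have : Finset.range (i + 1) ⊆ (Finset.range n).filter fun i => j ≤ nu i := by
      intro t ht
      rw [Finset.mem_range] at ht
      have ht' : j ≤ nu t := h.trans (h1 (by omega))
      rw [Finset.mem_filter, Finset.mem_range]
      refine ⟨?_, ht'⟩
      by_contra hc
      have := h3 t (by omega)
      omega
    have := Finset.card_le_card this
    rw [Finset.card_range] at this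
    omega
  · intro h
    by_contra hc
    have : ((Finset.range n).filter fun i => j ≤ nu i) ⊆ Finset.range i := by
      intro t ht
      rw [Finset.mem_filter] at ht
      rw [Finset.mem_range]
      by_contra hti
      exact hc (ht.2.trans (h1 (by omega)))
    have := Finset.card_le_card this
    rw [Finset.card_range] at this
    omega

lemma reindex (p : ℕ) {n : ℕ} (mu : Fin n → ℕ) (nu : Fin n → ℕ) (s : Equiv.Perm (Fin n))
    (h2 : ∀ i : Fin n, nu i = mu (s i)) :
    Nonempty ((∀ i, ZMod (p ^ nu i)) ≃+ ∀ i, ZMod (p ^ mu i)) := by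
  obtain rfl : nu = fun i => mu (s i) := funext h2
  exact ⟨(RingEquiv.piCongrLeft (fun i => ZMod (p ^ mu i)) s).toAddEquiv⟩

end HallCount

open HallCount in
/-- Lemma 1.4.1 in Butler: the number of subgroups of type `μ` in a finite abelian
`p`-group of type `λ` equals `∏_{j≥1} p^{μ'_j(λ'_j - μ'_j)} binom(λ'_j - μ'_{j+1}, λ'_j - μ'_j)_{p⁻¹}`. -/
theorem hall_subgroup_count (p : ℕ) (hp : p.Prime) (n : ℕ)
    (lam mu : Fin n → ℕ) (hsub : ∀ i, mu i ≤ lam i) :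
    (Nat.card {H : AddSubgroup (∀ i : Fin n, ZMod (p ^ lam i)) //
        Nonempty (H ≃+ ∀ i : Fin n, ZMod (p ^ mu i))} : ℚ)
      = ∏ j ∈ Finset.Icc 1 (∑ i, lam i),
          (p : ℚ) ^ (conjPart mu j * (conjPart lam j - conjPart mu j)) *
            gbinomQ ((p : ℚ)⁻¹) (conjPart lam j - conjPart mu (j + 1))
              (conjPart lam j - conjPart mu j) := by
  have hp1 : (1 : ℚ) < p := by exact_mod_cast hp.one_lt
  have hp0 : (p : ℚ) ≠ 0 := by positivity
  have fin : ∀ l : ℕ, NeZero (p ^ l) := fun l => ⟨(pow_pos hp.pos _).ne'⟩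
  obtain ⟨nu, s, h1, h2, h3⟩ := exists_sorted mu
  have hlt := le_iff_lt_conj mu nu s h1 h2 h3
  obtain ⟨e⟩ := reindex p mu (fun i => nu i) s h2
  have hcount := card_sub_mul (A := ∀ i : Fin n, ZMod (p ^ mu i)) (G := ∀ i : Fin n, ZMod (p ^ lam i))
  have hpos : injN (∀ i : Fin n, ZMod (p ^ mu i)) (∀ i : Fin n, ZMod (p ^ mu i)) ≠ 0 := by
    rw [injN_self]
    have : Finite ((∀ i : Fin n, ZMod (p ^ mu i)) ≃+ (∀ i : Fin n, ZMod (p ^ mu i))) :=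
      DFunLike.finite _
    exact Nat.card_ne_zero.2 ⟨⟨AddEquiv.refl _⟩, this⟩
  have hq : (Nat.card {H : AddSubgroup (∀ i : Fin n, ZMod (p ^ lam i)) //
        Nonempty (H ≃+ ∀ i : Fin n, ZMod (p ^ mu i))} : ℚ) =
      (injN (∀ i : Fin n, ZMod (p ^ mu i)) (∀ i : Fin n, ZMod (p ^ lam i)) : ℚ) /
        injN (∀ i : Fin n, ZMod (p ^ mu i)) (∀ i : Fin n, ZMod (p ^ mu i)) := by
    rw [eq_div_iff (by exact_mod_cast hpos)]
    exact_mod_cast hcount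
  rw [hq, ← injN_congr e, ← injN_congr e, injN_pi p hp nu h1, injN_pi p hp nu h1,
    ← Finset.prod_div_distrib]
  have hmono : Antitone (conjPart mu) := by
    intro a b hab
    apply Finset.card_le_card
    intro i
    simp only [Finset.mem_filter, Finset.mem_univ, true_and]
    omega
  have hml : ∀ j, conjPart mu j ≤ conjPart lam j := by
    intro j
    apply Finset.card_le_card
    intro i
    simp only [Finset.mem_filter, Finset.mem_univ, true_and]
    have := hsub i
    omega
  have hend : conjPart mu (∑ i, lam i + 1) = 0 := by
    rw [conjPart, Finset.card_eq_zero, Finset.filter_eq_empty_iff]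
    intro i _
    have a1 := hsub i
    have a2 := Finset.single_le_sum (f := lam) (fun _ _ => Nat.zero_le _) (Finset.mem_univ i)
    omega
  have hle : conjPart mu 1 ≤ n := by
    have := Finset.card_le_univ (Finset.univ.filter fun i => 1 ≤ mu i)
    simpa [conjPart] using this
  have hT : ∀ (la : Fin n → ℕ) (k : ℕ), (tor (∀ i : Fin n, ZMod (p ^ la i)) (p ^ k) : ℚ) =
      (p : ℚ) ^ ∑ j ∈ Finset.Icc 1 k, conjPart la j := by
    intro la k
    rw [tor_pi p hp, sum_min]
    push_cast
    rfl
  rw [telescoping (p : ℚ) hp1 (conjPart lam) (conjPart mu) hmono hml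
    (fun i => (if nu i = 0 then 1 else
        ((tor (∀ i : Fin n, ZMod (p ^ lam i)) (p ^ nu i) : ℚ) -
          (p : ℚ) ^ i * tor (∀ i : Fin n, ZMod (p ^ lam i)) (p ^ (nu i - 1)))) /
      (if nu i = 0 then 1 else
        ((tor (∀ i : Fin n, ZMod (p ^ mu i)) (p ^ nu i) : ℚ) -
          (p : ℚ) ^ i * tor (∀ i : Fin n, ZMod (p ^ mu i)) (p ^ (nu i - 1)))))]
  · rw [hend, zero_mul, pow_zero, mul_one, ← Finset.range_eq_Ico]
    symm
    apply Finset.prod_subset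
    · intro i
      simp only [Finset.mem_range]
      omega
    · intro i _ hi
      have : nu i = 0 := by
        have := (hlt 1 le_rfl i)
        rw [Finset.mem_range] at hi
        omega
      simp [this]
  · intro j i hi1 hi2
    have hj : nu i = j + 1 := by
      have a1 := hlt (j + 1) (by omega) i
      have a2 := hlt (j + 2) (by omega) i
      omega
    simp only [hj, if_neg (Nat.succ_ne_zero j), hT, Nat.add_sub_cancel]
    rw [Finset.sum_Icc_succ_top (by omega), Finset.sum_Icc_succ_top (by omega), pow_add, pow_add]
    have hD : ∑ t ∈ Finset.Icc 1 j, conjPart lam t = ∑ t ∈ Finset.Icc 1 j, (conjPart lam t - conjPart mu t)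
        + ∑ t ∈ Finset.Icc 1 j, conjPart mu t := by
      rw [← Finset.sum_add_distrib]
      apply Finset.sum_congr rfl
      intro t _
      have := hml t
      omega
    rw [hD, pow_add]
    have hden : (p : ℚ) ^ conjPart mu (j + 1) - (p : ℚ) ^ i ≠ 0 :=
      sub_ne_zero.2 (pow_lt_pow_right₀ hp1 hi2).ne'
    have hS : (p : ℚ) ^ (∑ t ∈ Finset.Icc 1 j, conjPart mu t) ≠ 0 := pow_ne_zero _ hp0
    rw [mul_comm ((p : ℚ) ^ i) ((p : ℚ) ^ (∑ t ∈ Finset.Icc 1 j, conjPart mu t)), ← mul_sub]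
    rw [mul_div_assoc', div_eq_div_iff (mul_ne_zero hS hden) hden]
    ring
end
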